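/- For every natural number k and every formula φ: (1) φ ∈ F_k^+ if and only if PNF(φ) ∩ Σ_{k+1}^+ ≠ ∅ and PNF(φ) ∩ Π_{k+1}^+ ≠ ∅; (2) φ ∈ E_{k+1} if and only if PNF(φ) ∩ Σ_{k+1} ≠ ∅ and PNF(φ) ∩ Π_{k+1}^+ = ∅; (3) φ ∈ U_{k+1} if and only if PNF(φ) ∩ Π_{k+1} ≠ ∅ and PNF(φ) ∩ Σ_{k+1}^+ = ∅; (4) φ ∈ PF_k if and only if PNF(φ) ∩ Σ_{k+1} ≠ ∅, PNF(φ) ∩ Π_{k+1} ≠ ∅, and PNF(φ) ∩ (Σ_k^+ ∪ Π_k^+) = ∅. -/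

import Mathlib

namespace PrenexPaper

/-- A first-order language: function symbols and relation symbols with arities. -/
structure Lang where
  Func : Type
  farity : Func → ℕ
  Rel : Type
  rarity : Rel → ℕ

/-- First-order terms over a language `L` with variables from `V`. -/
inductive Term (L : Lang) (V : Type) : Type
  | var : V → Term L V
  | func : (f : L.Func) → (Fin (L.farity f) → Term L V) → Term L V

/-- First-order formulas built from atomic formulas (including ⊥) by ∧, ∨, →, ∀x, ∃x. -/
inductive Fml (L : Lang) (V : Type) : Type
  | falsum : Fml L V
  | rel : (r : L.Rel) → (Fin (L.rarity r) → Term L V) → Fml L V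
  | and : Fml L V → Fml L V → Fml L V
  | or : Fml L V → Fml L V → Fml L V
  | imp : Fml L V → Fml L V → Fml L V
  | all : V → Fml L V → Fml L V
  | ex : V → Fml L V → Fml L V

variable {L : Lang} {V : Type}

/-- Variables occurring in a term. -/
def Term.vars : Term L V → Set V
  | .var x => {x}
  | .func _ ts => ⋃ i, (ts i).vars

/-- Free variables of a formula. -/
def Fml.fv : Fml L V → Set V
  | .falsum => ∅
  | .rel _ ts => ⋃ i, (ts i).vars
  | .and φ ψ => φ.fv ∪ ψ.fv
  | .or φ ψ => φ.fv ∪ ψ.fv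
  | .imp φ ψ => φ.fv ∪ ψ.fv
  | .all x φ => φ.fv \ {x}
  | .ex x φ => φ.fv \ {x}

/-- All variables appearing in a formula (free or bound). -/
def Fml.vars : Fml L V → Set V
  | .falsum => ∅
  | .rel _ ts => ⋃ i, (ts i).vars
  | .and φ ψ => φ.vars ∪ ψ.vars
  | .or φ ψ => φ.vars ∪ ψ.vars
  | .imp φ ψ => φ.vars ∪ ψ.vars
  | .all x φ => insert x φ.vars
  | .ex x φ => insert x φ.vars

/-- Number of quantifier occurrences. -/
def Fml.numQ : Fml L V → ℕ
  | .falsum => 0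
  | .rel _ _ => 0
  | .and φ ψ => φ.numQ + ψ.numQ
  | .or φ ψ => φ.numQ + ψ.numQ
  | .imp φ ψ => φ.numQ + ψ.numQ
  | .all _ φ => φ.numQ + 1
  | .ex _ φ => φ.numQ + 1

/-- Number of occurrences of the binary connectives ∧, ∨, →. -/
def Fml.numConn : Fml L V → ℕ
  | .falsum => 0
  | .rel _ _ => 0
  | .and φ ψ => φ.numConn + ψ.numConn + 1
  | .or φ ψ => φ.numConn + ψ.numConn + 1
  | .imp φ ψ => φ.numConn + ψ.numConn + 1
  | .all _ φ => φ.numConn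
  | .ex _ φ => φ.numConn

/-- Quantifier-free formulas. -/
def Fml.qf : Fml L V → Prop
  | .falsum => True
  | .rel _ _ => True
  | .and φ ψ => φ.qf ∧ ψ.qf
  | .or φ ψ => φ.qf ∧ ψ.qf
  | .imp φ ψ => φ.qf ∧ ψ.qf
  | .all _ _ => False
  | .ex _ _ => False

/-! ### Alternation paths and the classes E, U, F, PF

An alternation path is represented as a `List Bool`, where `true` stands for `+`
and `false` stands for `−` (alternation is automatic from the construction below). -/

/-- `s^⊥`: switch + and − in an alternation path. -/
def negPath (s : List Bool) : List Bool := s.map (fun b => !b)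

/-- The set `Alt(φ)` of alternation paths of a formula.  The first symbol `i(s)` of a
path `s` is `s.head?` (`none` corresponding to `×` for the empty path). -/
def Fml.alt : Fml L V → Set (List Bool)
  | .falsum => {[]}
  | .rel _ _ => {[]}
  | .and φ ψ => φ.alt ∪ ψ.alt
  | .or φ ψ => φ.alt ∪ ψ.alt
  | .imp φ ψ => (negPath '' φ.alt) ∪ ψ.alt
  | .all _ φ => {s ∈ φ.alt | s.head? = some false} ∪
      (fun s => false :: s) '' {s ∈ φ.alt | s.head? ≠ some false}
  | .ex _ φ => {s ∈ φ.alt | s.head? = some true} ∪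
      (fun s => true :: s) '' {s ∈ φ.alt | s.head? ≠ some true}

/-- The degree `deg(φ) = max { l(s) | s ∈ Alt(φ) }`. -/
noncomputable def Fml.deg (φ : Fml L V) : ℕ := sSup (List.length '' φ.alt)

/-- The class `F_k` of formulas of degree exactly `k`. -/
def Fc (k : ℕ) : Set (Fml L V) := {φ | φ.deg = k}

/-- The cumulative class `F_k^+` of formulas of degree at most `k`. -/
def FcP (k : ℕ) : Set (Fml L V) := {φ | φ.deg ≤ k}

/-- The class `U_k`. -/
def Uc : ℕ → Set (Fml L V)
  | 0 => Fc 0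
  | (k+1) => {φ | φ ∈ Fc (k+1) ∧ ∀ s ∈ φ.alt, s.length = k+1 → s.head? = some false}

/-- The class `E_k`. -/
def Ec : ℕ → Set (Fml L V)
  | 0 => Fc 0
  | (k+1) => {φ | φ ∈ Fc (k+1) ∧ ∀ s ∈ φ.alt, s.length = k+1 → s.head? = some true}

/-- The class `PF_k = F_k \ (E_k ∪ U_k)`. -/
def PFc (k : ℕ) : Set (Fml L V) := Fc k \ (Ec k ∪ Uc k)

/-- The cumulative class `U_k^+ = U_k ∪ ⋃_{i<k} F_i`. -/
def UcP (k : ℕ) : Set (Fml L V) := Uc k ∪ ⋃ i < k, Fc i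

/-- The cumulative class `E_k^+ = E_k ∪ ⋃_{i<k} F_i`. -/
def EcP (k : ℕ) : Set (Fml L V) := Ec k ∪ ⋃ i < k, Fc i

/-! ### The prenex classes Σ_k and Π_k -/

/-- Formulas `∃x₁⋯∃xₙ φ` with `n ≥ 1` and `φ ∈ S`. -/
inductive ExBlock (S : Set (Fml L V)) : Fml L V → Prop
  | one {x : V} {φ : Fml L V} : φ ∈ S → ExBlock S (.ex x φ)
  | more {x : V} {φ : Fml L V} : ExBlock S φ → ExBlock S (.ex x φ)

/-- Formulas `∀x₁⋯∀xₙ φ` with `n ≥ 1` and `φ ∈ S`. -/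
inductive AllBlock (S : Set (Fml L V)) : Fml L V → Prop
  | one {x : V} {φ : Fml L V} : φ ∈ S → AllBlock S (.all x φ)
  | more {x : V} {φ : Fml L V} : AllBlock S φ → AllBlock S (.all x φ)

/-- The pair `(Σ_k, Π_k)`. -/
def SP : ℕ → Set (Fml L V) × Set (Fml L V)
  | 0 => ({φ | φ.qf}, {φ | φ.qf})
  | (k+1) => ({φ | ExBlock (SP k).2 φ}, {φ | AllBlock (SP k).1 φ})

/-- The class `Σ_k`. -/
def SigmaC (k : ℕ) : Set (Fml L V) := (SP k).1

/-- The class `Π_k`. -/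
def PiC (k : ℕ) : Set (Fml L V) := (SP k).2

/-- The cumulative class `Σ_k^+ = Σ_k ∪ ⋃_{i<k} (Σ_i ∪ Π_i)`. -/
def SigmaP (k : ℕ) : Set (Fml L V) := SigmaC k ∪ ⋃ i < k, (SigmaC i ∪ PiC i)

/-- The cumulative class `Π_k^+ = Π_k ∪ ⋃_{i<k} (Σ_i ∪ Π_i)`. -/
def PiP (k : ℕ) : Set (Fml L V) := PiC k ∪ ⋃ i < k, (SigmaC i ∪ PiC i)

/-- A formula is in prenex normal form if it is in `Σ_k ∪ Π_k` for some `k`. -/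
def Prenex (φ : Fml L V) : Prop := ∃ k, φ ∈ SigmaC k ∪ PiC k

/-! ### Prenex transformations -/

variable [DecidableEq V]

/-- Replace the variable `x` by `y` in a term. -/
def Term.rename (x y : V) : Term L V → Term L V
  | .var z => if z = x then .var y else .var z
  | .func f ts => .func f (fun i => (ts i).rename x y)

/-- Replace the free occurrences of the variable `x` by `y` in a formula. -/
def Fml.rename (x y : V) : Fml L V → Fml L V
  | .falsum => .falsum
  | .rel r ts => .rel r (fun i => (ts i).rename x y)
  | .and φ ψ => .and (φ.rename x y) (ψ.rename x y)
  | .or φ ψ => .or (φ.rename x y) (ψ.rename x y)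
  | .imp φ ψ => .imp (φ.rename x y) (ψ.rename x y)
  | .all z φ => if z = x then .all z φ else .all z (φ.rename x y)
  | .ex z φ => if z = x then .ex z φ else .ex z (φ.rename x y)

/-- `φ ⊳ ψ` : `ψ` is a prenex transformation of `φ` (the eight rows of the table,
rows 3–8 for both quantifiers). -/
inductive Step : Fml L V → Fml L V → Prop
  | r1 (x : V) (ξ δ : Fml L V) (h : x ∉ δ.fv) :
      Step (.imp (.ex x ξ) δ) (.all x (.imp ξ δ))
  | r2 (x : V) (ξ δ : Fml L V) (h : x ∉ δ.fv) :
      Step (.imp (.all x ξ) δ) (.ex x (.imp ξ δ))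
  | r3all (x : V) (ξ δ : Fml L V) (h : x ∉ δ.fv) :
      Step (.imp δ (.all x ξ)) (.all x (.imp δ ξ))
  | r3ex (x : V) (ξ δ : Fml L V) (h : x ∉ δ.fv) :
      Step (.imp δ (.ex x ξ)) (.ex x (.imp δ ξ))
  | r4all (x : V) (ξ δ : Fml L V) (h : x ∉ δ.fv) :
      Step (.and (.all x ξ) δ) (.all x (.and ξ δ))
  | r4ex (x : V) (ξ δ : Fml L V) (h : x ∉ δ.fv) :
      Step (.and (.ex x ξ) δ) (.ex x (.and ξ δ))
  | r5all (x : V) (ξ δ : Fml L V) (h : x ∉ δ.fv) :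
      Step (.and δ (.all x ξ)) (.all x (.and δ ξ))
  | r5ex (x : V) (ξ δ : Fml L V) (h : x ∉ δ.fv) :
      Step (.and δ (.ex x ξ)) (.ex x (.and δ ξ))
  | r6all (x : V) (ξ δ : Fml L V) (h : x ∉ δ.fv) :
      Step (.or (.all x ξ) δ) (.all x (.or ξ δ))
  | r6ex (x : V) (ξ δ : Fml L V) (h : x ∉ δ.fv) :
      Step (.or (.ex x ξ) δ) (.ex x (.or ξ δ))
  | r7all (x : V) (ξ δ : Fml L V) (h : x ∉ δ.fv) :
      Step (.or δ (.all x ξ)) (.all x (.or δ ξ))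
  | r7ex (x : V) (ξ δ : Fml L V) (h : x ∉ δ.fv) :
      Step (.or δ (.ex x ξ)) (.ex x (.or δ ξ))
  | r8all (x y : V) (ξ : Fml L V) (h : y ∉ ξ.vars) :
      Step (.all x ξ) (.all y (ξ.rename x y))
  | r8ex (x y : V) (ξ : Fml L V) (h : y ∉ ξ.vars) :
      Step (.ex x ξ) (.ex y (ξ.rename x y))

/-- `Repl R φ ψ` : `ψ` is obtained from `φ` by replacing one occurrence of a
subformula `ξ` of `φ` with a formula `δ` such that `R ξ δ`. -/
inductive Repl (R : Fml L V → Fml L V → Prop) : Fml L V → Fml L V → Prop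
  | base {φ ψ : Fml L V} : R φ ψ → Repl R φ ψ
  | andL {φ φ' ψ : Fml L V} : Repl R φ φ' → Repl R (.and φ ψ) (.and φ' ψ)
  | andR {φ ψ ψ' : Fml L V} : Repl R ψ ψ' → Repl R (.and φ ψ) (.and φ ψ')
  | orL {φ φ' ψ : Fml L V} : Repl R φ φ' → Repl R (.or φ ψ) (.or φ' ψ)
  | orR {φ ψ ψ' : Fml L V} : Repl R ψ ψ' → Repl R (.or φ ψ) (.or φ ψ')
  | impL {φ φ' ψ : Fml L V} : Repl R φ φ' → Repl R (.imp φ ψ) (.imp φ' ψ)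
  | impR {φ ψ ψ' : Fml L V} : Repl R ψ ψ' → Repl R (.imp φ ψ) (.imp φ ψ')
  | allC {x : V} {φ φ' : Fml L V} : Repl R φ φ' → Repl R (.all x φ) (.all x φ')
  | exC {x : V} {φ φ' : Fml L V} : Repl R φ φ' → Repl R (.ex x φ) (.ex x φ')

/-- `φ ⊳* ψ` : `ψ` is obtained from `φ` by finitely many prenex transformations,
each applied to one occurrence of a subformula. -/
def DTA : Fml L V → Fml L V → Prop := Relation.ReflTransGen (Repl Step)

/-- `PNF(φ)` : the set of prenex normal forms reachable from `φ`. -/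
def PNF (φ : Fml L V) : Set (Fml L V) := {ψ | DTA φ ψ ∧ Prenex ψ}

/-! ### Tarskian semantics -/

/-- A structure for the language `L` with domain `M`. -/
structure Struc (L : Lang) (M : Type) where
  funcI : (f : L.Func) → (Fin (L.farity f) → M) → M
  relI : (r : L.Rel) → (Fin (L.rarity r) → M) → Prop

/-- Evaluation of a term in a structure under a variable assignment. -/
def Term.eval {M : Type} (S : Struc L M) (v : V → M) : Term L V → M
  | .var x => v x
  | .func f ts => S.funcI f (fun i => (ts i).eval S v)

/-- Tarskian satisfaction of a formula in a structure under a variable assignment. -/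
def Sat {M : Type} (S : Struc L M) (v : V → M) : Fml L V → Prop
  | .falsum => False
  | .rel r ts => S.relI r (fun i => (ts i).eval S v)
  | .and φ ψ => Sat S v φ ∧ Sat S v ψ
  | .or φ ψ => Sat S v φ ∨ Sat S v ψ
  | .imp φ ψ => Sat S v φ → Sat S v ψ
  | .all x φ => ∀ m : M, Sat S (Function.update v x m) φ
  | .ex x φ => ∃ m : M, Sat S (Function.update v x m) φ

/-! ### Helper material for the proof -/

/-- Weighted length of a path, as seen from an outer quantifier of polarity `b`. -/
def mu (b : Bool) (s : List Bool) : ℕ := if s.head? = some b then s.length else s.length + 1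

/-- `M φ true` / `M φ false`: least number of blocks when starting with ∃ / ∀. -/
def Fml.M : Fml L V → Bool → ℕ
  | .falsum, _ => 1
  | .rel _ _, _ => 1
  | .and φ ψ, b => max (φ.M b) (ψ.M b)
  | .or φ ψ, b => max (φ.M b) (ψ.M b)
  | .imp φ ψ, b => max (φ.M (!b)) (ψ.M b)
  | .all _ φ, b => if b then φ.M false + 1 else φ.M false
  | .ex _ φ, b => if b then φ.M true else φ.M true + 1

theorem mu_neg (b : Bool) (s : List Bool) : mu b (negPath s) = mu (!b) s := by
  cases s with
  | nil => simp [mu, negPath]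
  | cons a s => cases a <;> cases b <;> simp [mu, negPath]

theorem M_spec (φ : Fml L V) : ∀ b, (∀ s ∈ φ.alt, mu b s ≤ φ.M b) ∧ ∃ s ∈ φ.alt, mu b s = φ.M b := by
  induction φ with
  | falsum => intro b; simp [Fml.alt, mu, Fml.M]
  | rel r ts => intro b; simp [Fml.alt, mu, Fml.M]
  | and φ ψ h1 h2 | or φ ψ h1 h2 =>
    intro b
    obtain ⟨u1, s1, m1, e1⟩ := h1 b
    obtain ⟨u2, s2, m2, e2⟩ := h2 b
    simp only [Fml.alt, Fml.M]
    refine ⟨?_, ?_⟩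
    · rintro s (h | h)
      · exact (u1 s h).trans (le_max_left _ _)
      · exact (u2 s h).trans (le_max_right _ _)
    · rcases le_total (φ.M b) (ψ.M b) with h | h
      · exact ⟨s2, Or.inr m2, by rw [max_eq_right h, e2]⟩
      · exact ⟨s1, Or.inl m1, by rw [max_eq_left h, e1]⟩
  | imp φ ψ h1 h2 =>
    intro b
    obtain ⟨u1, s1, m1, e1⟩ := h1 (!b)
    obtain ⟨u2, s2, m2, e2⟩ := h2 b
    simp only [Fml.alt, Fml.M]
    refine ⟨?_, ?_⟩
    · rintro s (⟨t, h, rfl⟩ | h)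
      · rw [mu_neg]; exact (u1 t h).trans (le_max_left _ _)
      · exact (u2 s h).trans (le_max_right _ _)
    · rcases le_total (φ.M (!b)) (ψ.M b) with h | h
      · exact ⟨s2, Or.inr m2, by rw [max_eq_right h, e2]⟩
      · exact ⟨negPath s1, Or.inl ⟨s1, m1, rfl⟩, by rw [max_eq_left h, mu_neg, e1]⟩
  | all x φ ih =>
    intro b
    obtain ⟨u, s, m, e⟩ := ih false
    simp only [Fml.alt, Fml.M]
    refine ⟨?_, ?_⟩
    · rintro t (⟨h, h'⟩ | ⟨t, ⟨h, h'⟩, rfl⟩)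
      · have := u t h
        cases b <;> simp_all [mu]
      · have := u t h
        cases b <;> simp_all [mu]
    · by_cases h : s.head? = some false
      · exact ⟨s, Or.inl ⟨m, h⟩, by cases b <;> simp_all [mu]⟩
      · exact ⟨false :: s, Or.inr ⟨s, ⟨m, h⟩, rfl⟩, by cases b <;> simp_all [mu]⟩
  | ex x φ ih =>
    intro b
    obtain ⟨u, s, m, e⟩ := ih true
    simp only [Fml.alt, Fml.M]
    refine ⟨?_, ?_⟩
    · rintro t (⟨h, h'⟩ | ⟨t, ⟨h, h'⟩, rfl⟩)
      · have := u t h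
        cases b <;> simp_all [mu]
      · have := u t h
        cases b <;> simp_all [mu]
    · by_cases h : s.head? = some true
      · exact ⟨s, Or.inl ⟨m, h⟩, by cases b <;> simp_all [mu]⟩
      · exact ⟨true :: s, Or.inr ⟨s, ⟨m, h⟩, rfl⟩, by cases b <;> simp_all [mu]⟩

theorem len_le_mu (b : Bool) (s : List Bool) : s.length ≤ mu b s := by
  unfold mu; split <;> omega

theorem mu_le_len (b : Bool) (s : List Bool) : mu b s ≤ s.length + 1 := by
  unfold mu; split <;> omega

theorem deg_spec (φ : Fml L V) : (∀ s ∈ φ.alt, s.length ≤ φ.deg) ∧ ∃ s ∈ φ.alt, s.length = φ.deg := by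
  have hb : BddAbove (List.length '' φ.alt) := by
    refine ⟨φ.M true, ?_⟩
    rintro _ ⟨s, hs, rfl⟩
    exact (len_le_mu true s).trans ((M_spec φ true).1 s hs)
  have hn : (List.length '' φ.alt).Nonempty := by
    obtain ⟨s, hs, _⟩ := (M_spec φ true).2
    exact ⟨_, s, hs, rfl⟩
  refine ⟨fun s hs => le_csSup hb ⟨s, hs, rfl⟩, ?_⟩
  obtain ⟨s, hs, e⟩ := Nat.sSup_mem hn hb
  exact ⟨s, hs, e⟩

theorem one_le_M (φ : Fml L V) : ∀ b, 1 ≤ φ.M b := by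
  induction φ with
  | falsum => simp [Fml.M]
  | rel r ts => simp [Fml.M]
  | and φ ψ h1 h2 | or φ ψ h1 h2 | imp φ ψ h1 h2 =>
    intro b; simp only [Fml.M]; exact le_max_of_le_right (h2 b)
  | all x φ ih => intro b; have := ih false; simp only [Fml.M]; split <;> omega
  | ex x φ ih => intro b; have := ih true; simp only [Fml.M]; split <;> omega

theorem M_le_not (φ : Fml L V) : ∀ b, φ.M b ≤ φ.M (!b) + 1 := by
  induction φ with
  | falsum => simp [Fml.M]
  | rel r ts => simp [Fml.M]
  | and φ ψ h1 h2 | or φ ψ h1 h2 =>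
    intro b; have := h1 b; have := h2 b; simp only [Fml.M]; omega
  | imp φ ψ h1 h2 =>
    intro b; have := h1 (!b); have := h2 b; simp only [Fml.M]; omega
  | all x φ ih => intro b; cases b <;> simp [Fml.M]; omega
  | ex x φ ih => intro b; cases b <;> simp [Fml.M]; omega

theorem M_qf (φ : Fml L V) (h : φ.qf) : ∀ b, φ.M b = 1 := by
  induction φ with
  | falsum => simp [Fml.M]
  | rel r ts => simp [Fml.M]
  | and φ ψ h1 h2 | or φ ψ h1 h2 | imp φ ψ h1 h2 =>
    intro b; simp [Fml.M, h1 h.1, h2 h.2]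
  | all x φ ih => exact h.elim
  | ex x φ ih => exact h.elim

theorem qf_of_M (φ : Fml L V) (h : ∀ b, φ.M b ≤ 1) : φ.qf := by
  induction φ with
  | falsum => trivial
  | rel r ts => trivial
  | and φ ψ h1 h2 | or φ ψ h1 h2 =>
    simp only [Fml.M, max_le_iff] at h
    exact ⟨h1 fun b => (h b).1, h2 fun b => (h b).2⟩
  | imp φ ψ h1 h2 =>
    simp only [Fml.M, max_le_iff] at h
    exact ⟨h1 fun b => by simpa using (h (!b)).1, h2 fun b => (h b).2⟩
  | all x φ ih => have := h true; have := one_le_M φ false; simp [Fml.M] at *; omega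
  | ex x φ ih => have := h false; have := one_le_M φ true; simp [Fml.M] at *; omega

/-! #### Class membership in terms of `M` -/

theorem FcP_iff (k : ℕ) (φ : Fml L V) : φ ∈ FcP k ↔ ∀ b, φ.M b ≤ k + 1 := by
  obtain ⟨d1, s, hs, d2⟩ := deg_spec φ
  constructor
  · intro h b
    obtain ⟨t, ht, e⟩ := (M_spec φ b).2
    have := mu_le_len b t
    have := d1 t ht
    have : φ.deg ≤ k := h
    omega
  · intro h
    change φ.deg ≤ k
    have h1 := (M_spec φ true).1 s hs
    have h2 := (M_spec φ false).1 s hs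
    have h3 := h true
    have h4 := h false
    cases s with
    | nil => simp at d2; omega
    | cons a s => cases a <;> simp [mu] at * <;> omega

theorem cls_iff (k : ℕ) (φ : Fml L V) (b : Bool) :
    (φ ∈ Fc (k+1) ∧ ∀ s ∈ φ.alt, s.length = k+1 → s.head? = some b) ↔
      φ.M b = k + 1 ∧ φ.M (!b) = k + 2 := by
  obtain ⟨d1, s, hs, d2⟩ := deg_spec φ
  have hd : φ ∈ Fc (k+1) ↔ φ.deg = k+1 := Iff.rfl
  rw [hd]
  have u1 := (M_spec φ b).1
  have u2 := (M_spec φ (!b)).1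
  constructor
  · rintro ⟨h, h'⟩
    have hh := h' s hs (d2.trans h)
    have a1 := u1 s hs
    have a2 := u2 s hs
    have a3 : φ.M b ≤ k + 1 := by
      obtain ⟨t, ht, e⟩ := (M_spec φ b).2
      have := d1 t ht
      have h4 := h' t ht
      unfold mu at e
      split at e
      · omega
      · have : t.length ≠ k+1 := fun h => by simp_all
        omega
    have a4 := M_le_not φ (!b)
    cases b <;> simp_all [mu] <;> omega
  · rintro ⟨h, h'⟩
    have key : ∀ t ∈ φ.alt, t.length ≤ k+1 ∧ (t.length = k+1 → t.head? = some b) := by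
      intro t ht
      have := u1 t ht
      unfold mu at this
      split at this
      · exact ⟨by omega, fun _ => by assumption⟩
      · exact ⟨by omega, fun _ => by omega⟩
    refine ⟨?_, fun t ht => (key t ht).2⟩
    obtain ⟨t, ht, e⟩ := (M_spec φ (!b)).2
    have h1 := mu_le_len (!b) t
    have h2 := d1 t ht
    have h3 := (key s hs).1
    omega

theorem Ec_iff (k : ℕ) (φ : Fml L V) :
    φ ∈ Ec (k+1) ↔ φ.M true = k + 1 ∧ φ.M false = k + 2 := cls_iff k φ true

theorem Uc_iff (k : ℕ) (φ : Fml L V) :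
    φ ∈ Uc (k+1) ↔ φ.M false = k + 1 ∧ φ.M true = k + 2 := cls_iff k φ false

theorem PFc_iff (k : ℕ) (φ : Fml L V) :
    φ ∈ PFc k ↔ k ≠ 0 ∧ φ.M true = k + 1 ∧ φ.M false = k + 1 := by
  cases k with
  | zero => simp [PFc, Ec, Uc]
  | succ k =>
    have hF : φ ∈ Fc (k+1) ↔ φ ∈ FcP (k+1) ∧ ¬ φ ∈ FcP k := by
      change φ.deg = k+1 ↔ φ.deg ≤ k+1 ∧ ¬ φ.deg ≤ k
      omega
    rw [PFc, Set.mem_sdiff, Set.mem_union, Ec_iff, Uc_iff, hF, FcP_iff, FcP_iff]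
    simp only [Bool.forall_bool]
    have h1 := M_le_not φ true
    have h2 := M_le_not φ false
    simp at h1 h2
    omega

/-! #### Prenex formulas -/

/-- A quantifier with sign: `true` is ∃, `false` is ∀. -/
def Qn (b : Bool) (x : V) (φ : Fml L V) : Fml L V := if b then .ex x φ else .all x φ

/-- Prenex formulas, inductively. -/
inductive Pre : Fml L V → Prop
  | qf {φ : Fml L V} : φ.qf → Pre φ
  | q {φ : Fml L V} (b : Bool) (x : V) : Pre φ → Pre (Qn b x φ)

theorem M_Qn (b c : Bool) (x : V) (φ : Fml L V) :
    (Qn b x φ).M c = if b = c then φ.M b else φ.M b + 1 := by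
  cases b <;> cases c <;> simp [Qn, Fml.M]

theorem SigmaC_succ (k : ℕ) (φ : Fml L V) : φ ∈ SigmaC (k+1) ↔ ExBlock (PiC k) φ := Iff.rfl
theorem PiC_succ (k : ℕ) (φ : Fml L V) : φ ∈ PiC (k+1) ↔ AllBlock (SigmaC k) φ := Iff.rfl
theorem SigmaC_zero (φ : Fml L V) : φ ∈ SigmaC 0 ↔ φ.qf := Iff.rfl
theorem PiC_zero (φ : Fml L V) : φ ∈ PiC 0 ↔ φ.qf := Iff.rfl

theorem Pre_cls {φ : Fml L V} (h : Pre φ) :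
    φ.qf ∨ (∃ k, φ ∈ SigmaC (k+1) ∧ φ.M true = k+1) ∨ (∃ k, φ ∈ PiC (k+1) ∧ φ.M false = k+1) := by
  induction h with
  | qf h => exact Or.inl h
  | @q φ b x h ih =>
    right
    cases b with
    | true =>
      left
      rcases ih with h | ⟨k, h, e⟩ | ⟨k, h, e⟩
      · exact ⟨0, ExBlock.one h, by simp [M_Qn, M_qf _ h]⟩
      · exact ⟨k, ExBlock.more h, by simp [M_Qn, e]⟩
      · by_cases h0 : φ.M true = k + 2
        · exact ⟨k+1, ExBlock.one h, by simp [M_Qn, h0]⟩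
        · exfalso
          have h' : AllBlock (SigmaC k) φ := h
          cases h' <;> simp [Fml.M] at e h0 <;> omega
    | false =>
      right
      rcases ih with h | ⟨k, h, e⟩ | ⟨k, h, e⟩
      · exact ⟨0, AllBlock.one h, by simp [M_Qn, M_qf _ h]⟩
      · by_cases h0 : φ.M false = k + 2
        · exact ⟨k+1, AllBlock.one h, by simp [M_Qn, h0]⟩
        · exfalso
          have h' : ExBlock (PiC k) φ := h
          cases h' <;> simp [Fml.M] at e h0 <;> omega
      · exact ⟨k, AllBlock.more h, by simp [M_Qn, e]⟩

theorem Pre_Prenex {φ : Fml L V} (h : Pre φ) : Prenex φ := by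
  rcases Pre_cls h with h | ⟨k, h, _⟩ | ⟨k, h, _⟩
  · exact ⟨0, Or.inl h⟩
  · exact ⟨k+1, Or.inl h⟩
  · exact ⟨k+1, Or.inr h⟩

theorem M_SP (k : ℕ) : ∀ φ : Fml L V,
    (φ ∈ SigmaC k → φ.M true ≤ max k 1 ∧ φ.M false ≤ k + 1) ∧
    (φ ∈ PiC k → φ.M false ≤ max k 1 ∧ φ.M true ≤ k + 1) := by
  induction k with
  | zero =>
    intro φ
    rw [SigmaC_zero, PiC_zero]
    constructor <;> intro h <;> simp [M_qf φ h]
  | succ k ih =>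
    intro φ
    rw [SigmaC_succ, PiC_succ]
    constructor
    · intro h
      induction h with
      | @one x φ h => have := (ih φ).2 h; simp [Fml.M]; omega
      | @more x φ h ih => simp [Fml.M]; omega
    · intro h
      induction h with
      | @one x φ h => have := (ih φ).1 h; simp [Fml.M]; omega
      | @more x φ h ih => simp [Fml.M]; omega

theorem M_low {k : ℕ} {φ : Fml L V} (h : φ ∈ ⋃ i < k, (SigmaC i ∪ PiC i)) (b : Bool) :
    φ.M b ≤ k := by
  simp only [Set.mem_iUnion, Set.mem_union] at h
  obtain ⟨i, hi, h | h⟩ := h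
  · have := (M_SP i φ).1 h
    cases b <;> omega
  · have := (M_SP i φ).2 h
    cases b <;> omega

theorem M_SigmaP {k : ℕ} {φ : Fml L V} (h : φ ∈ SigmaP (k+1)) : φ.M true ≤ k + 1 := by
  rcases h with h | h
  · have := (M_SP _ φ).1 h; omega
  · exact M_low h true

theorem M_PiP {k : ℕ} {φ : Fml L V} (h : φ ∈ PiP (k+1)) : φ.M false ≤ k + 1 := by
  rcases h with h | h
  · have := (M_SP _ φ).2 h; omega
  · exact M_low h false

theorem Pre_SigmaP {k : ℕ} {φ : Fml L V} (h : Pre φ) (hM : φ.M true ≤ k + 1) :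
    φ ∈ SigmaP (k+1) := by
  simp only [SigmaP, Set.mem_union, Set.mem_iUnion]
  rcases Pre_cls h with h | ⟨i, h, e⟩ | ⟨i, h, e⟩
  · exact Or.inr ⟨0, by omega, Or.inl h⟩
  · rcases Nat.lt_or_ge i k with hi | hi
    · exact Or.inr ⟨i+1, by omega, Or.inl h⟩
    · have : i = k := by omega
      subst this; exact Or.inl h
  · refine Or.inr ⟨i+1, ?_, Or.inr h⟩
    have h' : AllBlock (SigmaC i) φ := h
    cases h' <;> simp [Fml.M] at e hM <;> omega

theorem Pre_PiP {k : ℕ} {φ : Fml L V} (h : Pre φ) (hM : φ.M false ≤ k + 1) :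
    φ ∈ PiP (k+1) := by
  simp only [PiP, Set.mem_union, Set.mem_iUnion]
  rcases Pre_cls h with h | ⟨i, h, e⟩ | ⟨i, h, e⟩
  · exact Or.inr ⟨0, by omega, Or.inl h⟩
  · refine Or.inr ⟨i+1, ?_, Or.inl h⟩
    have h' : ExBlock (PiC i) φ := h
    cases h' <;> simp [Fml.M] at e hM <;> omega
  · rcases Nat.lt_or_ge i k with hi | hi
    · exact Or.inr ⟨i+1, by omega, Or.inr h⟩
    · have : i = k := by omega
      subst this; exact Or.inl h

/-! #### Monotonicity along prenex transformations -/

theorem M_rename (x y : V) (φ : Fml L V) : ∀ b, (φ.rename x y).M b = φ.M b := by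
  induction φ with
  | falsum => intro b; rfl
  | rel r ts => intro b; rfl
  | and φ ψ h1 h2 | or φ ψ h1 h2 | imp φ ψ h1 h2 =>
    intro b; simp [Fml.rename, Fml.M, h1, h2]
  | all z φ ih | ex z φ ih =>
    intro b; simp only [Fml.rename]; split
    · rfl
    · simp [Fml.M, ih]

theorem Step_mono {φ ψ : Fml L V} (h : Step φ ψ) : ∀ b, φ.M b ≤ ψ.M b := by
  intro b
  have hn := fun (χ : Fml L V) => M_le_not χ true
  have hn' := fun (χ : Fml L V) => M_le_not χ false
  have ho := fun (χ : Fml L V) => one_le_M χ b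
  simp only [Bool.not_true, Bool.not_false] at hn hn'
  cases h with
  | r8all x y ξ h => simp [Fml.M, M_rename]
  | r8ex x y ξ h => simp [Fml.M, M_rename]
  | _ x ξ δ h =>
    have a1 := hn ξ
    have a2 := hn δ
    have a3 := hn' ξ
    have a4 := hn' δ
    cases b <;> simp [Fml.M] <;> omega

theorem Repl_mono {φ ψ : Fml L V} (h : Repl Step φ ψ) : ∀ b, φ.M b ≤ ψ.M b := by
  induction h with
  | base h => exact Step_mono h
  | andL h ih | orL h ih => intro b; have := ih b; simp only [Fml.M]; omega
  | andR h ih | orR h ih => intro b; have := ih b; simp only [Fml.M]; omega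
  | impL h ih => intro b; have := ih (!b); simp only [Fml.M]; omega
  | impR h ih => intro b; have := ih b; simp only [Fml.M]; omega
  | allC h ih => intro b; have := ih false; simp only [Fml.M]; split <;> omega
  | exC h ih => intro b; have := ih true; simp only [Fml.M]; split <;> omega

theorem DTA_mono {φ ψ : Fml L V} (h : DTA φ ψ) (b : Bool) : φ.M b ≤ ψ.M b := by
  induction h with
  | refl => exact le_rfl
  | tail _ h ih => exact ih.trans (Repl_mono h b)

/-! #### Existence of optimal prenex forms -/

theorem Term.vars_finite (t : Term L V) : t.vars.Finite := by
  induction t with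
  | var x => exact Set.finite_singleton x
  | func f ts ih => exact Set.finite_iUnion ih

theorem Fml.vars_finite (φ : Fml L V) : φ.vars.Finite := by
  induction φ with
  | falsum => exact Set.finite_empty
  | rel r ts => exact Set.finite_iUnion fun i => (ts i).vars_finite
  | and φ ψ h1 h2 | or φ ψ h1 h2 | imp φ ψ h1 h2 => exact h1.union h2
  | all x φ ih | ex x φ ih => exact ih.insert x

theorem Fml.fv_finite (φ : Fml L V) : φ.fv.Finite := by
  induction φ with
  | falsum => exact Set.finite_empty
  | rel r ts => exact Set.finite_iUnion fun i => (ts i).vars_finite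
  | and φ ψ h1 h2 | or φ ψ h1 h2 | imp φ ψ h1 h2 => exact h1.union h2
  | all x φ ih | ex x φ ih => exact ih.sdiff

theorem exists_fresh [Infinite V] (φ ψ : Fml L V) : ∃ y, y ∉ φ.vars ∧ y ∉ ψ.fv := by
  obtain ⟨y, hy⟩ := (φ.vars_finite.union ψ.fv_finite).exists_notMem
  exact ⟨y, fun h => hy (Or.inl h), fun h => hy (Or.inr h)⟩

theorem qf_rename (x y : V) (φ : Fml L V) (h : φ.qf) : (φ.rename x y).qf := by
  induction φ with
  | falsum => trivial
  | rel r ts => trivial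
  | and φ ψ h1 h2 | or φ ψ h1 h2 | imp φ ψ h1 h2 => exact ⟨h1 h.1, h2 h.2⟩
  | all x φ ih => exact h.elim
  | ex x φ ih => exact h.elim

theorem Pre_rename (x y : V) {φ : Fml L V} (h : Pre φ) : Pre (φ.rename x y) := by
  induction h with
  | qf h => exact Pre.qf (qf_rename x y _ h)
  | @q φ b z h ih =>
    have : (Qn b z φ).rename x y = if z = x then Qn b z φ else Qn b z (φ.rename x y) := by
      cases b <;> simp [Qn, Fml.rename]
    rw [this]
    split
    · exact Pre.q b z h
    · exact Pre.q b z ih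

theorem numQ_rename (x y : V) (φ : Fml L V) : (φ.rename x y).numQ = φ.numQ := by
  induction φ with
  | falsum => rfl
  | rel r ts => rfl
  | and φ ψ h1 h2 | or φ ψ h1 h2 | imp φ ψ h1 h2 => simp [Fml.rename, Fml.numQ, h1, h2]
  | all z φ ih | ex z φ ih =>
    simp only [Fml.rename]; split
    · rfl
    · simp [Fml.numQ, ih]

/-- Binary connectives. -/
inductive BOp
  | and | or | imp

/-- Apply a binary connective. -/
def BOp.mk : BOp → Fml L V → Fml L V → Fml L V
  | .and, φ, ψ => .and φ ψ
  | .or, φ, ψ => .or φ ψ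
  | .imp, φ, ψ => .imp φ ψ

/-- Polarity transfer of the left argument. -/
def BOp.fl : BOp → Bool → Bool
  | .and, b => b
  | .or, b => b
  | .imp, b => !b

theorem BOp.fl_fl (o : BOp) (b : Bool) : o.fl (o.fl b) = b := by
  cases o <;> simp [BOp.fl]

theorem BOp.fl_not (o : BOp) (b : Bool) : o.fl (!b) = !(o.fl b) := by
  cases o <;> simp [BOp.fl]

theorem M_mk (o : BOp) (φ ψ : Fml L V) (b : Bool) :
    (o.mk φ ψ).M b = max (φ.M (o.fl b)) (ψ.M b) := by
  cases o <;> simp [BOp.mk, BOp.fl, Fml.M]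

theorem DTA_lift {f : Fml L V → Fml L V} (hf : ∀ φ ψ, Repl Step φ ψ → Repl Step (f φ) (f ψ))
    {φ ψ : Fml L V} (h : DTA φ ψ) : DTA (f φ) (f ψ) :=
  Relation.ReflTransGen.lift f hf _ _ h

theorem DTA_Qn (b : Bool) (x : V) {φ ψ : Fml L V} (h : DTA φ ψ) : DTA (Qn b x φ) (Qn b x ψ) := by
  refine DTA_lift (f := Qn b x) (fun φ ψ h => ?_) h
  cases b
  · exact Repl.allC h
  · exact Repl.exC h

theorem Repl_mkL (o : BOp) (χ : Fml L V) {φ ψ : Fml L V} (h : Repl Step φ ψ) :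
    Repl Step (o.mk φ χ) (o.mk ψ χ) := by
  cases o
  · exact Repl.andL h
  · exact Repl.orL h
  · exact Repl.impL h

theorem Repl_mkR (o : BOp) (χ : Fml L V) {φ ψ : Fml L V} (h : Repl Step φ ψ) :
    Repl Step (o.mk χ φ) (o.mk χ ψ) := by
  cases o
  · exact Repl.andR h
  · exact Repl.orR h
  · exact Repl.impR h

theorem DTA_mk (o : BOp) {φ φ' ψ ψ' : Fml L V} (h : DTA φ φ') (h' : DTA ψ ψ') :
    DTA (o.mk φ ψ) (o.mk φ' ψ') :=
  Relation.ReflTransGen.trans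
    (DTA_lift (f := fun χ => o.mk χ ψ) (fun _ _ h => Repl_mkL o ψ h) h)
    (DTA_lift (f := fun χ => o.mk φ' χ) (fun _ _ h => Repl_mkR o φ' h) h')

theorem Step_rename (b : Bool) (x y : V) (ξ : Fml L V) (h : y ∉ ξ.vars) :
    Step (Qn b x ξ) (Qn b y (ξ.rename x y)) := by
  cases b
  · exact Step.r8all x y ξ h
  · exact Step.r8ex x y ξ h

theorem Step_L (o : BOp) (b : Bool) (x : V) (ξ δ : Fml L V) (h : x ∉ δ.fv) :
    Step (o.mk (Qn b x ξ) δ) (Qn (o.fl b) x (o.mk ξ δ)) := by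
  cases o <;> cases b
  · exact Step.r4all x ξ δ h
  · exact Step.r4ex x ξ δ h
  · exact Step.r6all x ξ δ h
  · exact Step.r6ex x ξ δ h
  · exact Step.r2 x ξ δ h
  · exact Step.r1 x ξ δ h

theorem Step_R (o : BOp) (b : Bool) (x : V) (ξ δ : Fml L V) (h : x ∉ δ.fv) :
    Step (o.mk δ (Qn b x ξ)) (Qn b x (o.mk δ ξ)) := by
  cases o <;> cases b
  · exact Step.r5all x ξ δ h
  · exact Step.r5ex x ξ δ h
  · exact Step.r7all x ξ δ h
  · exact Step.r7ex x ξ δ h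
  · exact Step.r3all x ξ δ h
  · exact Step.r3ex x ξ δ h

theorem pullL [Infinite V] (o : BOp) (b : Bool) (x : V) (ξ δ : Fml L V) (hp : Pre ξ) :
    ∃ (y : V) (ξ' : Fml L V), DTA (o.mk (Qn b x ξ) δ) (Qn (o.fl b) y (o.mk ξ' δ)) ∧ Pre ξ' ∧
      ξ'.numQ = ξ.numQ ∧ ∀ c, ξ'.M c = ξ.M c := by
  obtain ⟨y, h1, h2⟩ := exists_fresh ξ δ
  refine ⟨y, ξ.rename x y, ?_, Pre_rename x y hp, numQ_rename x y ξ, M_rename x y ξ⟩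
  exact (Relation.ReflTransGen.single (Repl_mkL o δ (Repl.base (Step_rename b x y ξ h1)))).tail
    (Repl.base (Step_L o b y _ δ h2))

theorem pullR [Infinite V] (o : BOp) (b : Bool) (x : V) (ξ δ : Fml L V) (hp : Pre ξ) :
    ∃ (y : V) (ξ' : Fml L V), DTA (o.mk δ (Qn b x ξ)) (Qn b y (o.mk δ ξ')) ∧ Pre ξ' ∧
      ξ'.numQ = ξ.numQ ∧ ∀ c, ξ'.M c = ξ.M c := by
  obtain ⟨y, h1, h2⟩ := exists_fresh ξ δ
  refine ⟨y, ξ.rename x y, ?_, Pre_rename x y hp, numQ_rename x y ξ, M_rename x y ξ⟩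
  exact (Relation.ReflTransGen.single (Repl_mkR o δ (Repl.base (Step_rename b x y ξ h1)))).tail
    (Repl.base (Step_R o b y _ δ h2))

theorem numQ_Qn (b : Bool) (x : V) (φ : Fml L V) : (Qn b x φ).numQ = φ.numQ + 1 := by
  cases b <;> simp [Qn, Fml.numQ]

theorem merge [Infinite V] (o : BOp) (n : ℕ) : ∀ (φ ψ : Fml L V), Pre φ → Pre ψ →
    φ.numQ + ψ.numQ = n → ∀ b, ∃ χ, Pre χ ∧ DTA (o.mk φ ψ) χ ∧ χ.M b ≤ (o.mk φ ψ).M b := by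
  induction n with
  | zero =>
    intro φ ψ hφ hψ hn b
    cases hφ with
    | q c x h => rw [numQ_Qn] at hn; omega
    | qf h1 =>
      cases hψ with
      | q c x h => rw [numQ_Qn] at hn; omega
      | qf h2 =>
        exact ⟨_, Pre.qf (by cases o <;> exact ⟨h1, h2⟩), Relation.ReflTransGen.refl, le_rfl⟩
  | succ n ih =>
    -- pulling a left quantifier, aiming for leading sign `b`
    have goL : ∀ (c : Bool) (x : V) (ξ ψ : Fml L V), Pre ξ → Pre ψ → ξ.numQ + ψ.numQ = n →
        ∃ χ, Pre χ ∧ DTA (o.mk (Qn c x ξ) ψ) χ ∧ ∀ d, χ.M d ≤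
          if o.fl c = d then max (ξ.M c) (ψ.M (o.fl c)) else max (ξ.M c) (ψ.M (o.fl c)) + 1 := by
      intro c x ξ ψ h1 h2 hn
      obtain ⟨y, ξ', hd, hp, hq, hM⟩ := pullL o c x ξ ψ h1
      obtain ⟨χ, p, d, e⟩ := ih ξ' ψ hp h2 (by omega) (o.fl c)
      refine ⟨Qn (o.fl c) y χ, Pre.q _ _ p, Relation.ReflTransGen.trans hd (DTA_Qn _ _ d), ?_⟩
      intro d
      rw [M_mk, o.fl_fl, hM] at e
      rw [M_Qn]
      split <;> omega
    have goR : ∀ (c : Bool) (x : V) (ξ φ : Fml L V), Pre ξ → Pre φ → φ.numQ + ξ.numQ = n →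
        ∃ χ, Pre χ ∧ DTA (o.mk φ (Qn c x ξ)) χ ∧ ∀ d, χ.M d ≤
          if c = d then max (φ.M (o.fl c)) (ξ.M c) else max (φ.M (o.fl c)) (ξ.M c) + 1 := by
      intro c x ξ φ h1 h2 hn
      obtain ⟨y, ξ', hd, hp, hq, hM⟩ := pullR o c x ξ φ h1
      obtain ⟨χ, p, d, e⟩ := ih φ ξ' h2 hp (by omega) c
      refine ⟨Qn c y χ, Pre.q _ _ p, Relation.ReflTransGen.trans hd (DTA_Qn _ _ d), ?_⟩
      intro d
      rw [M_mk, hM] at e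
      rw [M_Qn]
      split <;> omega
    intro φ ψ hφ hψ hn b
    rw [M_mk]
    cases hφ with
    | qf h1 =>
      cases hψ with
      | qf h2 =>
        exact ⟨_, Pre.qf (by cases o <;> exact ⟨h1, h2⟩), Relation.ReflTransGen.refl,
          by rw [M_mk]⟩
      | @q ξ c x h =>
        rw [numQ_Qn] at hn
        obtain ⟨χ, p, d, e⟩ := goR c x ξ φ h (Pre.qf h1) (by omega)
        refine ⟨χ, p, d, (e b).trans ?_⟩
        rw [M_Qn, M_qf φ h1, M_qf φ h1]
        have := one_le_M ξ c
        split <;> omega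
    | @q ξ c x h =>
      rw [numQ_Qn] at hn
      by_cases hc : o.fl c = b
      · obtain ⟨χ, p, d, e⟩ := goL c x ξ ψ h hψ (by omega)
        refine ⟨χ, p, d, (e b).trans ?_⟩
        subst hc
        simp [M_Qn, o.fl_fl]
      · have hcb : o.fl b = !c := by
          clear goL goR ih hn
          revert hc; cases o <;> cases b <;> cases c <;> simp [BOp.fl]
        cases hψ with
        | qf h2 =>
          obtain ⟨χ, p, d, e⟩ := goL c x ξ ψ h (Pre.qf h2) (by omega)
          refine ⟨χ, p, d, (e b).trans ?_⟩
          rw [M_Qn, M_qf ψ h2, M_qf ψ h2, if_neg hc, if_neg (by rw [hcb]; simp)]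
          have := one_le_M ξ c
          omega
        | @q ζ c' x' h' =>
          by_cases hb : c' = b
          · subst hb
            obtain ⟨χ, p, d, e⟩ := goR c' x' ζ (Qn c x ξ) h' (Pre.q c x h) (by
              rw [numQ_Qn] at *; omega)
            refine ⟨χ, p, d, (e c').trans ?_⟩
            simp [M_Qn]
          · obtain ⟨χ, p, d, e⟩ := goL c x ξ (Qn c' x' ζ) h (Pre.q c' x' h') (by omega)
            refine ⟨χ, p, d, (e b).trans ?_⟩
            have hcc : c' = o.fl c := by
              revert hc hb; cases o.fl c <;> cases b <;> cases c' <;> simp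
            rw [if_neg hc]
            simp only [M_Qn, hcb]
            rw [if_pos hcc, if_neg hb]
            simp

theorem optimal [Infinite V] (φ : Fml L V) : ∀ b, ∃ χ, Pre χ ∧ DTA φ χ ∧ χ.M b ≤ φ.M b := by
  have key : ∀ (o : BOp) (φ ψ : Fml L V), (∀ b, ∃ χ, Pre χ ∧ DTA φ χ ∧ χ.M b ≤ φ.M b) →
      (∀ b, ∃ χ, Pre χ ∧ DTA ψ χ ∧ χ.M b ≤ ψ.M b) →
      ∀ b, ∃ χ, Pre χ ∧ DTA (o.mk φ ψ) χ ∧ χ.M b ≤ (o.mk φ ψ).M b := by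
    intro o φ ψ h1 h2 b
    obtain ⟨χ1, p1, d1, e1⟩ := h1 (o.fl b)
    obtain ⟨χ2, p2, d2, e2⟩ := h2 b
    obtain ⟨χ, p, d, e⟩ := merge o _ χ1 χ2 p1 p2 rfl b
    refine ⟨χ, p, Relation.ReflTransGen.trans (DTA_mk o d1 d2) d, ?_⟩
    rw [M_mk] at *
    omega
  have keyQ : ∀ (c : Bool) (x : V) (φ : Fml L V), (∀ b, ∃ χ, Pre χ ∧ DTA φ χ ∧ χ.M b ≤ φ.M b) →
      ∀ b, ∃ χ, Pre χ ∧ DTA (Qn c x φ) χ ∧ χ.M b ≤ (Qn c x φ).M b := by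
    intro c x φ h b
    obtain ⟨χ, p, d, e⟩ := h c
    refine ⟨Qn c x χ, Pre.q c x p, DTA_Qn c x d, ?_⟩
    rw [M_Qn, M_Qn]
    split <;> omega
  induction φ with
  | falsum => exact fun b => ⟨.falsum, Pre.qf (by trivial), Relation.ReflTransGen.refl, le_rfl⟩
  | rel r ts => exact fun b => ⟨.rel r ts, Pre.qf (by trivial), Relation.ReflTransGen.refl, le_rfl⟩
  | and φ ψ h1 h2 => exact key .and φ ψ h1 h2
  | or φ ψ h1 h2 => exact key .or φ ψ h1 h2
  | imp φ ψ h1 h2 => exact key .imp φ ψ h1 h2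
  | all x φ ih => exact keyQ false x φ ih
  | ex x φ ih => exact keyQ true x φ ih

theorem ne_SigmaP [Infinite V] (k : ℕ) (φ : Fml L V) :
    PNF φ ∩ SigmaP (k+1) ≠ ∅ ↔ φ.M true ≤ k + 1 := by
  rw [← Set.nonempty_iff_ne_empty]
  constructor
  · rintro ⟨ψ, ⟨h, _⟩, h'⟩
    exact (DTA_mono h true).trans (M_SigmaP h')
  · intro h
    obtain ⟨χ, p, d, e⟩ := optimal φ true
    exact ⟨χ, ⟨d, Pre_Prenex p⟩, Pre_SigmaP p (e.trans h)⟩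

theorem ne_PiP [Infinite V] (k : ℕ) (φ : Fml L V) :
    PNF φ ∩ PiP (k+1) ≠ ∅ ↔ φ.M false ≤ k + 1 := by
  rw [← Set.nonempty_iff_ne_empty]
  constructor
  · rintro ⟨ψ, ⟨h, _⟩, h'⟩
    exact (DTA_mono h false).trans (M_PiP h')
  · intro h
    obtain ⟨χ, p, d, e⟩ := optimal φ false
    exact ⟨χ, ⟨d, Pre_Prenex p⟩, Pre_PiP p (e.trans h)⟩

/-- If no low-level prenex form can exist, the optimal one is exactly in `Σ_{k+1}`. -/
theorem ne_SigmaC [Infinite V] (k : ℕ) (φ : Fml L V) (h : φ.M true ≤ k + 1)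
    (hlow : ∀ ψ ∈ PNF φ, ψ ∉ ⋃ i < k + 1, (SigmaC i ∪ PiC i)) :
    PNF φ ∩ SigmaC (k+1) ≠ ∅ := by
  obtain ⟨ψ, h1, h2⟩ := Set.nonempty_iff_ne_empty.2 ((ne_SigmaP k φ).2 h)
  rcases h2 with h2 | h2
  · exact Set.nonempty_iff_ne_empty.1 ⟨ψ, h1, h2⟩
  · exact (hlow ψ h1 h2).elim

theorem ne_PiC [Infinite V] (k : ℕ) (φ : Fml L V) (h : φ.M false ≤ k + 1)
    (hlow : ∀ ψ ∈ PNF φ, ψ ∉ ⋃ i < k + 1, (SigmaC i ∪ PiC i)) :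
    PNF φ ∩ PiC (k+1) ≠ ∅ := by
  obtain ⟨ψ, h1, h2⟩ := Set.nonempty_iff_ne_empty.2 ((ne_PiP k φ).2 h)
  rcases h2 with h2 | h2
  · exact Set.nonempty_iff_ne_empty.1 ⟨ψ, h1, h2⟩
  · exact (hlow ψ h1 h2).elim

theorem M_of_SigmaC {k : ℕ} {φ : Fml L V} (h : PNF φ ∩ SigmaC (k+1) ≠ ∅) : φ.M true ≤ k + 1 := by
  obtain ⟨ψ, ⟨h1, _⟩, h2⟩ := Set.nonempty_iff_ne_empty.2 h
  exact (DTA_mono h1 true).trans (M_SigmaP (Or.inl h2))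

theorem M_of_PiC {k : ℕ} {φ : Fml L V} (h : PNF φ ∩ PiC (k+1) ≠ ∅) : φ.M false ≤ k + 1 := by
  obtain ⟨ψ, ⟨h1, _⟩, h2⟩ := Set.nonempty_iff_ne_empty.2 h
  exact (DTA_mono h1 false).trans (M_PiP (Or.inl h2))

/-- Main Theorem:
(1) φ ∈ F_k^+ iff PNF(φ) ∩ Σ_{k+1}^+ ≠ ∅ and PNF(φ) ∩ Π_{k+1}^+ ≠ ∅;
(2) φ ∈ E_{k+1} iff PNF(φ) ∩ Σ_{k+1} ≠ ∅ and PNF(φ) ∩ Π_{k+1}^+ = ∅;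
(3) φ ∈ U_{k+1} iff PNF(φ) ∩ Π_{k+1} ≠ ∅ and PNF(φ) ∩ Σ_{k+1}^+ = ∅;
(4) φ ∈ PF_k iff PNF(φ) ∩ Σ_{k+1} ≠ ∅, PNF(φ) ∩ Π_{k+1} ≠ ∅ and
    PNF(φ) ∩ (Σ_k^+ ∪ Π_k^+) = ∅. -/
theorem stmt19 {L : Lang} {V : Type} [DecidableEq V] [Infinite V] (k : ℕ) (φ : Fml L V) :
    (φ ∈ FcP k ↔ PNF φ ∩ SigmaP (k+1) ≠ ∅ ∧ PNF φ ∩ PiP (k+1) ≠ ∅) ∧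
    (φ ∈ Ec (k+1) ↔ PNF φ ∩ SigmaC (k+1) ≠ ∅ ∧ PNF φ ∩ PiP (k+1) = ∅) ∧
    (φ ∈ Uc (k+1) ↔ PNF φ ∩ PiC (k+1) ≠ ∅ ∧ PNF φ ∩ SigmaP (k+1) = ∅) ∧
    (φ ∈ PFc k ↔ PNF φ ∩ SigmaC (k+1) ≠ ∅ ∧ PNF φ ∩ PiC (k+1) ≠ ∅ ∧
      PNF φ ∩ (SigmaP k ∪ PiP k) = ∅) := by
  have n1 := M_le_not φ true
  have n2 := M_le_not φ false
  simp only [Bool.not_true, Bool.not_false] at n1 n2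
  refine ⟨?_, ?_, ?_, ?_⟩
  · rw [FcP_iff, ne_SigmaP, ne_PiP, Bool.forall_bool, and_comm]
  · have e : PNF φ ∩ PiP (k+1) = ∅ ↔ ¬ φ.M false ≤ k + 1 := by rw [← ne_PiP, not_not]
    rw [Ec_iff, e]
    constructor
    · rintro ⟨h1, h2⟩
      refine ⟨ne_SigmaC k φ h1.le fun ψ hψ hl => ?_, by omega⟩
      have := M_low hl false
      have := DTA_mono hψ.1 false
      omega
    · rintro ⟨h1, h2⟩
      have := M_of_SigmaC h1
      omega
  · have e : PNF φ ∩ SigmaP (k+1) = ∅ ↔ ¬ φ.M true ≤ k + 1 := by rw [← ne_SigmaP, not_not]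
    rw [Uc_iff, e]
    constructor
    · rintro ⟨h1, h2⟩
      refine ⟨ne_PiC k φ h1.le fun ψ hψ hl => ?_, by omega⟩
      have := M_low hl true
      have := DTA_mono hψ.1 true
      omega
    · rintro ⟨h1, h2⟩
      have := M_of_PiC h1
      omega
  · rw [PFc_iff]
    constructor
    · rintro ⟨hk, h1, h2⟩
      obtain ⟨k, rfl⟩ := Nat.exists_eq_succ_of_ne_zero hk
      have low : ∀ ψ ∈ PNF φ, ψ ∉ SigmaP (k+1) ∪ PiP (k+1) := by
        rintro ψ hψ (h | h)
        · have := M_SigmaP h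
          have := DTA_mono hψ.1 true
          omega
        · have := M_PiP h
          have := DTA_mono hψ.1 false
          omega
      have low' : ∀ ψ ∈ PNF φ, ψ ∉ ⋃ i < k + 1 + 1, (SigmaC i ∪ PiC i) := by
        intro ψ hψ h
        apply low ψ hψ
        simp only [Set.mem_iUnion] at h
        obtain ⟨i, hi, h⟩ := h
        rcases Nat.lt_or_ge i (k+1) with hik | hik
        · left; right
          simp only [Set.mem_iUnion]
          exact ⟨i, hik, h⟩
        · have : i = k + 1 := by omega
          subst this
          rcases h with h | h
          · exact Or.inl (Or.inl h)
          · exact Or.inr (Or.inl h)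
      refine ⟨ne_SigmaC (k+1) φ h1.le low', ne_PiC (k+1) φ h2.le low', ?_⟩
      exact Set.eq_empty_of_forall_notMem fun ψ h => low ψ h.1 h.2
    · rintro ⟨h1, h2, h3⟩
      have m1 := M_of_SigmaC h1
      have m2 := M_of_PiC h2
      cases k with
      | zero =>
        exfalso
        have hq : φ.qf := qf_of_M φ (by simp only [Bool.forall_bool]; omega)
        have : φ ∈ PNF φ ∩ (SigmaP 0 ∪ PiP 0) :=
          ⟨⟨Relation.ReflTransGen.refl, 0, Or.inl hq⟩, Or.inl (Or.inl hq)⟩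
        rw [h3] at this
        exact this
      | succ k =>
        have e1 : ¬ φ.M true ≤ k + 1 := by
          rw [← ne_SigmaP, ← Set.nonempty_iff_ne_empty]
          rintro ⟨ψ, a, b⟩
          exact Set.notMem_empty ψ (h3 ▸ ⟨a, Or.inl b⟩)
        have e2 : ¬ φ.M false ≤ k + 1 := by
          rw [← ne_PiP, ← Set.nonempty_iff_ne_empty]
          rintro ⟨ψ, a, b⟩
          exact Set.notMem_empty ψ (h3 ▸ ⟨a, Or.inr b⟩)
        omega

end PrenexPaper
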